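/- arXiv:2601.00957 — 2 statements merged into one kernel-verified Lean document; each statement's English description precedes it below -/
import Mathlib

section
/- Let G = (G_k,A_k,B_k) ∘ (G_{k−1},A_{k−1},B_{k−1}) ∘ ⋯ ∘ (G_1,A_1,B_1) ∘ G_0 be any iterated composition of split graphs (G_i,A_i,B_i), i = 1,…,k, with a nonempty graph G_0. Then α(G) = |B_k| + |B_{k−1}| + ⋯ + |B_1| + α(G_0) and β(G) = |A_k| + |A_{k−1}| + ⋯ + |A_1| + β(G_0), where α denotes the independence number and β the minimum size of a vertex cover. -/
namespace Tysh

open SimpleGraph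

variable {V : Type}

/-- A set of vertices is independent (stable). -/
def IsIndep (G : SimpleGraph V) (s : Set V) : Prop :=
  ∀ ⦃u⦄, u ∈ s → ∀ ⦃v⦄, v ∈ s → u ≠ v → ¬ G.Adj u v

/-- `(A, B)` is a KS-partition of `G`: `A` induces a clique, `B` an independent set,
and they partition the vertex set. -/
def IsKSPartition (G : SimpleGraph V) (A B : Set V) : Prop :=
  G.IsClique A ∧ IsIndep G B ∧ A ∪ B = Set.univ ∧ Disjoint A B

/-- A split graph is one admitting a KS-partition. -/
def IsSplit (G : SimpleGraph V) : Prop := ∃ A B, IsKSPartition G A B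

/-- Independence number. -/
noncomputable def indepNum (G : SimpleGraph V) : ℕ := Gᶜ.cliqueNum

/-- `G` is decomposable: its vertices can be partitioned into `A ∪ B` (a nonempty split
graph with KS-partition `(A,B)`) and a nonempty part `W`, with all `A`–`W` edges present
and no `B`–`W` edges; i.e. `G` is (isomorphic to) the composition `(G[A∪B],A,B) ∘ G[W]`. -/
def Decomposable (G : SimpleGraph V) : Prop :=
  ∃ A B W : Set V,
    (A ∪ B) ∪ W = Set.univ ∧ Disjoint A B ∧ Disjoint (A ∪ B) W ∧
    (A ∪ B).Nonempty ∧ W.Nonempty ∧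
    G.IsClique A ∧ IsIndep G B ∧
    (∀ a ∈ A, ∀ w ∈ W, G.Adj a w) ∧
    (∀ b ∈ B, ∀ w ∈ W, ¬ G.Adj b w)

/-- The composition `(G,A,B) ∘ H` of a split graph `G` (with clique part `A`)
with a graph `H`. -/
def comp {α β : Type} (G : SimpleGraph α) (A : Set α) (H : SimpleGraph β) :
    SimpleGraph (α ⊕ β) :=
  SimpleGraph.fromRel (fun x y =>
    match x, y with
    | .inl a, .inl a' => G.Adj a a'
    | .inr b, .inr b' => H.Adj b b'
    | .inl a, .inr _ => a ∈ A
    | .inr _, .inl _ => False)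

/-- The iterated composition `(G_k,A_k,B_k) ∘ ⋯ ∘ (G_1,A_1,B_1) ∘ G_0`
(component `0` is `G_0`; the clique part `A i` of component `i` is joined to
all components with smaller index). -/
def iterComp {k : ℕ} {Vi : Fin (k+1) → Type} (Gi : ∀ i, SimpleGraph (Vi i))
    (A : ∀ i, Set (Vi i)) : SimpleGraph (Σ i, Vi i) :=
  SimpleGraph.fromRel (fun x y =>
    (∃ h : x.1 = y.1, (Gi y.1).Adj (h ▸ x.2) y.2) ∨ (y.1 < x.1 ∧ x.2 ∈ A x.1))

/-- The multiset of vertex degrees of a finite graph. -/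
noncomputable def degMultiset {V : Type} [Fintype V] (G : SimpleGraph V) : Multiset ℕ :=
  Finset.univ.val.map fun v => (G.neighborSet v).ncard

/-- A unigraph is a graph determined up to isomorphism by its degree sequence. -/
def Unigraph {V : Type} [Fintype V] (G : SimpleGraph V) : Prop :=
  ∀ (W : Type) [Fintype W] (H : SimpleGraph W),
    degMultiset G = degMultiset H → Nonempty (G ≃g H)


/-- `S` is a fixing set of `G`: the only automorphism fixing `S` pointwise is the identity. -/
def IsFixingSet (G : SimpleGraph V) (S : Set V) : Prop :=
  ∀ π : G ≃g G, (∀ v ∈ S, π v = v) → ∀ v, π v = v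

/-- The fixing number of `G`: the least size of a fixing set. -/
noncomputable def fixingNumber (G : SimpleGraph V) : ℕ :=
  sInf {n | ∃ S : Set V, S.ncard = n ∧ IsFixingSet G S}

/-- `φ` is a distinguishing labeling of `G`: the only automorphism preserving `φ`
is the identity. -/
def IsDistinguishing {C : Type*} (G : SimpleGraph V) (φ : V → C) : Prop :=
  ∀ π : G ≃g G, (∀ v, φ (π v) = φ v) → ∀ v, π v = v

/-- The distinguishing number of `G`: the least number of colors in a distinguishing
labeling. -/
noncomputable def distinguishingNumber (G : SimpleGraph V) : ℕ :=
  sInf {r | ∃ φ : V → Fin r, IsDistinguishing G φ}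

/-- The minimum size of a vertex cover of `G`. -/
noncomputable def vcNum (G : SimpleGraph V) : ℕ :=
  sInf {n | ∃ S : Set V, S.ncard = n ∧ ∀ ⦃u v⦄, G.Adj u v → u ∈ S ∨ v ∈ S}

theorem indepNum_eq (G : SimpleGraph V) : indepNum G = G.indepNum := cliqueNum_compl

theorem IsIndep.ncard_le_indepNum [Finite V] {G : SimpleGraph V} {s : Set V} (hs : IsIndep G s) :
    s.ncard ≤ indepNum G := by
  rw [indepNum_eq, Set.ncard_eq_toFinset_card s]
  refine IsIndepSet.card_le_indepNum ?_
  rw [Set.Finite.coe_toFinset]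
  exact hs

theorem exists_isIndep_ncard_eq [Finite V] (G : SimpleGraph V) :
    ∃ s, IsIndep G s ∧ s.ncard = indepNum G := by
  obtain ⟨s, hs⟩ := G.exists_isNIndepSet_indepNum
  exact ⟨s, hs.isIndepSet, by rw [Set.ncard_coe_finset, hs.card_eq, indepNum_eq]⟩

theorem one_le_indepNum [Finite V] [Nonempty V] (G : SimpleGraph V) : 1 ≤ indepNum G := by
  have v := Classical.arbitrary V
  have h : IsIndep G {v} := fun a ha b hb hab => (hab (ha.trans hb.symm)).elim
  simpa using h.ncard_le_indepNum

theorem isIndep_compl_iff (G : SimpleGraph V) (s : Set V) :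
    IsIndep G sᶜ ↔ ∀ ⦃u v⦄, G.Adj u v → u ∈ s ∨ v ∈ s := by
  refine ⟨fun h u v huv => ?_, fun h u hu v hv _ huv => (h huv).elim hu hv⟩
  by_contra! hc
  exact h hc.1 hc.2 huv.ne huv

/-- Gallai's identity for independent sets and vertex covers. -/
theorem indepNum_add_vcNum [Finite V] (G : SimpleGraph V) :
    indepNum G + vcNum G = Nat.card V := by
  obtain ⟨s, hs, hcard⟩ := exists_isIndep_ncard_eq G
  have hmem : sᶜ.ncard ∈ {n | ∃ S : Set V, S.ncard = n ∧
      ∀ ⦃u v⦄, G.Adj u v → u ∈ S ∨ v ∈ S} :=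
    ⟨sᶜ, rfl, (isIndep_compl_iff G _).1 (by rwa [compl_compl])⟩
  have hle : vcNum G ≤ sᶜ.ncard := Nat.sInf_le hmem
  obtain ⟨t, ht, hcover⟩ : vcNum G ∈ _ := Nat.sInf_mem ⟨_, hmem⟩
  have htc := ((isIndep_compl_iff G t).2 hcover).ncard_le_indepNum
  have h₁ := Set.ncard_add_ncard_compl s
  have h₂ := Set.ncard_add_ncard_compl t
  omega

theorem ncard_sigma_eq_sum {ι : Type} [Fintype ι] {X : ι → Type} [∀ i, Finite (X i)]
    (S : Set (Σ i, X i)) : S.ncard = ∑ i, (Sigma.mk i ⁻¹' S).ncard := by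
  classical
  have := fun i => Fintype.ofFinite (X i)
  have h : S = (Finset.univ.sigma fun i => (Sigma.mk i ⁻¹' S).toFinset : Finset (Σ i, X i)) := by
    ext ⟨i, x⟩
    simp
  conv_lhs => rw [h]
  rw [Set.ncard_coe_finset, Finset.card_sigma]
  simp only [Set.ncard_eq_toFinset_card']

section IterComp

variable {k : ℕ} {Vi : Fin (k + 1) → Type} {Gi : ∀ i, SimpleGraph (Vi i)}
  {A B : ∀ i, Set (Vi i)}

theorem iterComp_adj_same {i : Fin (k + 1)} {x y : Vi i} :
    (iterComp Gi A).Adj ⟨i, x⟩ ⟨i, y⟩ ↔ (Gi i).Adj x y := by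
  simp only [iterComp, fromRel_adj, lt_irrefl, false_and, or_false, exists_true_left, ne_eq]
  refine ⟨?_, fun h => ⟨by simpa using h.ne, Or.inl h⟩⟩
  rintro ⟨-, h | h⟩
  exacts [h, h.symm]

theorem iterComp_adj_of_lt {i j : Fin (k + 1)} (hij : i < j) {x : Vi j} {y : Vi i} :
    (iterComp Gi A).Adj ⟨j, x⟩ ⟨i, y⟩ ↔ x ∈ A j := by
  simp [iterComp, fromRel_adj, hij, hij.ne, hij.ne', hij.not_gt]

theorem IsIndep.iterComp_preimage {S : Set (Σ i, Vi i)} (hS : IsIndep (iterComp Gi A) S)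
    (i : Fin (k + 1)) : IsIndep (Gi i) (Sigma.mk i ⁻¹' S) := fun x hx y hy hxy h =>
  hS hx hy (by simpa using hxy) (iterComp_adj_same.2 h)

theorem IsIndep.ncard_le_iterComp [∀ i, Finite (Vi i)] [Nonempty (Vi 0)]
    (hKS : ∀ i, i ≠ 0 → IsKSPartition (Gi i) (A i) (B i)) (hA0 : A 0 = ∅)
    {S : Set (Σ i, Vi i)} (hS : IsIndep (iterComp Gi A) S) :
    S.ncard ≤ (∑ i, (B i).ncard) + indepNum (Gi 0) := by
  have mem_B : ∀ i, i ≠ 0 → ∀ x, x ∉ A i → x ∈ B i := fun i hi x hx =>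
    (((hKS i hi).2.2.1.symm ▸ Set.mem_univ x : x ∈ A i ∪ B i)).resolve_left hx
  obtain ⟨i₀, h⟩ : ∃ i₀, ∀ i, (Sigma.mk i ⁻¹' S).ncard ≤
      (B i).ncard + if i = i₀ then indepNum (Gi 0) else 0 := by
    by_cases hA : ∃ i, ∃ a ∈ A i, (⟨i, a⟩ : Σ i, Vi i) ∈ S
    · obtain ⟨i, a, ha, haS⟩ := hA
      have hi : i ≠ 0 := by
        rintro rfl
        simp [hA0] at ha
      refine ⟨i, fun j => ?_⟩
      rcases lt_trichotomy j i with hj | rfl | hj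
      · have : Sigma.mk j ⁻¹' S = ∅ := Set.eq_empty_of_forall_notMem fun x hx =>
          hS haS hx (by simp [hj.ne']) ((iterComp_adj_of_lt hj).2 ha)
        simp [this]
      · have hsub : Sigma.mk j ⁻¹' S ⊆ insert a (B j) := fun x hx => by
          by_cases hxa : x = a
          · exact Or.inl hxa
          · exact Or.inr (mem_B j hi x fun hxA =>
              hS.iterComp_preimage j hx haS hxa ((hKS j hi).1 hxA ha hxa))
        have h₁ := Set.ncard_le_ncard hsub
        have h₂ := Set.ncard_insert_le a (B j)
        have h₃ := one_le_indepNum (Gi 0)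
        simp only [if_true]
        omega
      · rw [if_neg hj.ne', add_zero]
        refine Set.ncard_le_ncard fun x hx => mem_B j (Fin.ne_zero_of_lt hj) x fun hxA => ?_
        exact hS hx haS (by simp [hj.ne']) ((iterComp_adj_of_lt hj).2 hxA)
    · push Not at hA
      refine ⟨0, fun i => ?_⟩
      by_cases hi : i = 0
      · subst hi
        simpa using Nat.le_add_left_of_le (hS.iterComp_preimage 0).ncard_le_indepNum
      · rw [if_neg hi, add_zero]
        exact Set.ncard_le_ncard fun x hx => mem_B i hi x fun hxA => hA i x hxA hx
  calc S.ncard = ∑ i, (Sigma.mk i ⁻¹' S).ncard := ncard_sigma_eq_sum S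
    _ ≤ ∑ i, ((B i).ncard + if i = i₀ then indepNum (Gi 0) else 0) :=
      Finset.sum_le_sum fun i _ => h i
    _ = _ := by simp [Finset.sum_add_distrib]

theorem le_indepNum_iterComp [∀ i, Finite (Vi i)]
    (hKS : ∀ i, i ≠ 0 → IsKSPartition (Gi i) (A i) (B i)) (hB0 : B 0 = ∅) :
    (∑ i, (B i).ncard) + indepNum (Gi 0) ≤ indepNum (iterComp Gi A) := by
  obtain ⟨s, hs, hcard⟩ := exists_isIndep_ncard_eq (Gi 0)
  let C := Function.update B 0 s
  have hC0 : C 0 = s := Function.update_self ..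
  have hC : ∀ i, i ≠ 0 → C i = B i := fun i hi => Function.update_of_ne hi ..
  have hCi : ∀ i, IsIndep (Gi i) (C i) := fun i => by
    by_cases hi : i = 0
    · subst hi
      rwa [hC0]
    · rw [hC i hi]
      exact (hKS i hi).2.1
  have hlt : ∀ {i j : Fin (k + 1)}, i < j → ∀ {x : Vi j} {y : Vi i}, x ∈ C j →
      ¬ (iterComp Gi A).Adj ⟨j, x⟩ ⟨i, y⟩ := fun {i j} hij {x y} hx h => by
    have hj := Fin.ne_zero_of_lt hij
    rw [hC j hj] at hx
    exact Set.disjoint_left.1 (hKS j hj).2.2.2 ((iterComp_adj_of_lt hij).1 h) hx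
  have hind : IsIndep (iterComp Gi A) {v | v.2 ∈ C v.1} := by
    rintro ⟨i, x⟩ hx ⟨j, y⟩ hy hne h
    rcases lt_trichotomy i j with hij | rfl | hij
    · exact hlt hij hy h.symm
    · exact hCi i hx hy (by simpa using hne) (iterComp_adj_same.1 h)
    · exact hlt hij hx h
  refine le_trans (le_of_eq ?_) hind.ncard_le_indepNum
  rw [ncard_sigma_eq_sum, Fin.sum_univ_succ, Fin.sum_univ_succ]
  have h0 : Sigma.mk 0 ⁻¹' {v : Σ i, Vi i | v.2 ∈ C v.1} = s := hC0
  have h1 : ∀ i : Fin k, Sigma.mk i.succ ⁻¹' {v : Σ i, Vi i | v.2 ∈ C v.1} = B i.succ :=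
    fun i => hC _ i.succ_ne_zero
  simp only [h0, h1, hB0, hcard, Set.ncard_empty]
  omega

end IterComp

/-- For any iterated composition `G = (G_k,A_k,B_k) ∘ ⋯ ∘ (G_1,A_1,B_1) ∘ G_0` of split
graphs with a nonempty `G_0`, `α(G) = |B_k| + ⋯ + |B_1| + α(G_0)` and
`β(G) = |A_k| + ⋯ + |A_1| + β(G_0)`. -/
theorem indepNum_vcNum_iterComp {k : ℕ} (Vi : Fin (k + 1) → Type)
    [∀ i, Fintype (Vi i)] [Nonempty (Vi 0)]
    (Gi : ∀ i, SimpleGraph (Vi i)) (A B : ∀ i, Set (Vi i))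
    (hKS : ∀ i, i ≠ 0 → IsKSPartition (Gi i) (A i) (B i))
    (hA0 : A 0 = ∅) (hB0 : B 0 = ∅) :
    indepNum (iterComp Gi A) = (∑ i, (B i).ncard) + indepNum (Gi 0) ∧
    vcNum (iterComp Gi A) = (∑ i, (A i).ncard) + vcNum (Gi 0) := by
  have hα : indepNum (iterComp Gi A) = (∑ i, (B i).ncard) + indepNum (Gi 0) := by
    obtain ⟨S, hS, hcard⟩ := exists_isIndep_ncard_eq (iterComp Gi A)
    exact le_antisymm (hcard ▸ hS.ncard_le_iterComp hKS hA0) (le_indepNum_iterComp hKS hB0)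
  refine ⟨hα, ?_⟩
  have hsum : Nat.card (Σ i, Vi i) =
      (∑ i, (A i).ncard) + (∑ i, (B i).ncard) + Nat.card (Vi 0) := by
    have hi : ∀ i : Fin k,
        Nat.card (Vi i.succ) = (A i.succ).ncard + (B i.succ).ncard := fun i => by
      obtain ⟨-, -, hU, hD⟩ := hKS i.succ i.succ_ne_zero
      rw [← Set.ncard_union_eq hD, hU, Set.ncard_univ]
    rw [Nat.card_sigma, ← Finset.sum_add_distrib, Fin.sum_univ_succ, Fin.sum_univ_succ]
    simp only [hi, hA0, hB0, Set.ncard_empty]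
    omega
  have h := indepNum_add_vcNum (iterComp Gi A)
  have h₀ := indepNum_add_vcNum (Gi 0)
  omega

end Tysh
end

section
/- Let G* = (G,A,B) ∘ H be the composition of a split graph G with KS-partition (A,B) and a nonempty graph H, let u ∈ V(G) and v ∈ V(H). Then there exists an automorphism π of G* with π(u) = v if and only if one of the following holds: (i) u ∈ A, B ∪ {u} is an independent set of G, and v is a dominant vertex of H; or (ii) u ∈ B, A ∪ {u} is a clique of G, and v is an isolated vertex of H. -/
namespace Tysh

open SimpleGraph

variable {V : Type}

@[simp]
theorem comp_adj_inl_inl {α β : Type} (G : SimpleGraph α) (A : Set α) (H : SimpleGraph β)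
    (a a' : α) : (comp G A H).Adj (.inl a) (.inl a') ↔ G.Adj a a' := by
  simpa [comp, G.adj_comm a' a] using fun h : G.Adj a a' => h.ne

@[simp]
theorem comp_adj_inr_inr {α β : Type} (G : SimpleGraph α) (A : Set α) (H : SimpleGraph β)
    (b b' : β) : (comp G A H).Adj (.inr b) (.inr b') ↔ H.Adj b b' := by
  simpa [comp, H.adj_comm b' b] using fun h : H.Adj b b' => h.ne

@[simp]
theorem comp_adj_inl_inr {α β : Type} (G : SimpleGraph α) (A : Set α) (H : SimpleGraph β)
    (a : α) (b : β) : (comp G A H).Adj (.inl a) (.inr b) ↔ a ∈ A := by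
  simp [comp]

@[simp]
theorem comp_adj_inr_inl {α β : Type} (G : SimpleGraph α) (A : Set α) (H : SimpleGraph β)
    (a : α) (b : β) : (comp G A H).Adj (.inr b) (.inl a) ↔ a ∈ A := by
  simp [comp]

/-- Two vertices with the same neighbors, apart from themselves, are exchanged by an
automorphism. -/
theorem exists_iso_of_twins (G : SimpleGraph V) {x y : V}
    (h : ∀ w, w ≠ x → w ≠ y → (G.Adj x w ↔ G.Adj y w)) : ∃ π : G ≃g G, π x = y := by
  classical
  refine ⟨⟨Equiv.swap x y, ?_⟩, Equiv.swap_apply_left x y⟩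
  intro a b
  have hcomm := G.adj_comm
  have hirr : ∀ v, ¬ G.Adj v v := fun v => G.irrefl
  simp only [Equiv.swap_apply_def]
  grind

/-- In a finite graph, vertices in the same orbit whose neighborhoods, apart from the two
vertices, are nested have the same neighbors. -/
theorem twins_of_nested_of_iso [Finite V] (G : SimpleGraph V) {x y : V} (π : G ≃g G)
    (hπ : π x = y) (h : ∀ w, w ≠ x → w ≠ y → G.Adj x w → G.Adj y w) :
    ∀ w, w ≠ x → w ≠ y → (G.Adj x w ↔ G.Adj y w) := by
  have hcard : (G.neighborSet x).ncard = (G.neighborSet y).ncard := by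
    rw [← hπ]
    exact Nat.card_congr (π.mapNeighborSet x)
  have hcard' : (G.neighborSet x \ {y}).ncard = (G.neighborSet y \ {x}).ncard := by
    by_cases hxy : G.Adj x y
    · rw [Set.ncard_sdiff_singleton_of_mem (by simpa using hxy),
        Set.ncard_sdiff_singleton_of_mem (by simpa using hxy.symm), hcard]
    · rw [Set.sdiff_singleton_eq_self (by simpa using hxy),
        Set.sdiff_singleton_eq_self (by simpa [G.adj_comm] using hxy), hcard]
  have hsub : G.neighborSet x \ {y} ⊆ G.neighborSet y \ {x} :=
    fun w hw => ⟨h w (G.ne_of_adj hw.1).symm hw.2 hw.1, (G.ne_of_adj hw.1).symm⟩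
  have heq := Set.eq_of_subset_of_ncard_le hsub hcard'.ge
  intro w hwx hwy
  simpa [hwx, hwy] using Set.ext_iff.mp heq w

/-- The crossing conditions say exactly that the two vertices are twins in the composition. -/
theorem comp_twins_iff {α β : Type} (G : SimpleGraph α) (A B : Set α) (H : SimpleGraph β)
    (hKS : IsKSPartition G A B) (u : α) (v : β) :
    (∀ w, w ≠ Sum.inl u → w ≠ Sum.inr v →
        ((comp G A H).Adj (Sum.inl u) w ↔ (comp G A H).Adj (Sum.inr v) w)) ↔
      ((u ∈ A ∧ IsIndep G (B ∪ {u}) ∧ ∀ w, w ≠ v → H.Adj v w) ∨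
       (u ∈ B ∧ G.IsClique (A ∪ {u}) ∧ ∀ w, ¬ H.Adj v w)) := by
  obtain ⟨hA, hB, hAB, hdisj⟩ := hKS
  have hcover : ∀ a, a ∈ A ∨ a ∈ B := fun a => by
    simpa using (Set.ext_iff.mp hAB a)
  have hnot : ∀ a, a ∈ A → a ∉ B := fun _ ha => Set.disjoint_left.mp hdisj ha
  have hcomm := G.adj_comm
  have hirr := H.irrefl (v := v)
  simp only [Sum.forall, comp_adj_inl_inl, comp_adj_inl_inr, comp_adj_inr_inl,
    comp_adj_inr_inr, ne_eq, Sum.inl.injEq, Sum.inr.injEq, reduceCtorEq, not_false_eq_true,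
    true_imp_iff, IsIndep, SimpleGraph.IsClique, Set.Pairwise, Set.mem_union,
    Set.mem_singleton_iff] at *
  rcases hcover u with hu | hu <;> grind

/-- Let `G* = (G,A,B) ∘ H` with `H` nonempty. There is an automorphism of `G*` mapping
`u ∈ V(G)` to `v ∈ V(H)` iff either `u ∈ A` is a swing vertex (`B ∪ {u}` independent)
and `v` is a dominant vertex of `H`, or `u ∈ B` is a swing vertex (`A ∪ {u}` a clique)
and `v` is an isolated vertex of `H`. -/
theorem automorphism_crossing_iff {α β : Type} [Fintype α] [Fintype β]
    (G : SimpleGraph α) (A B : Set α) (H : SimpleGraph β) [Nonempty β]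
    (hKS : IsKSPartition G A B) (u : α) (v : β) :
    (∃ π : comp G A H ≃g comp G A H, π (Sum.inl u) = Sum.inr v) ↔
      ((u ∈ A ∧ IsIndep G (B ∪ {u}) ∧ ∀ w, w ≠ v → H.Adj v w) ∨
       (u ∈ B ∧ G.IsClique (A ∪ {u}) ∧ ∀ w, ¬ H.Adj v w)) := by
  rw [← comp_twins_iff G A B H hKS u v]
  refine ⟨?_, fun h => exists_iso_of_twins _ h⟩
  rintro ⟨π, hπ⟩
  by_cases hu : u ∈ A
  · have htwins := twins_of_nested_of_iso (comp G A H) π.symm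
      (π.symm_apply_eq.mpr hπ.symm) (by
        rintro (a | b) hv hu' hadj
        · simp only [comp_adj_inr_inl, comp_adj_inl_inl] at hadj ⊢
          exact hKS.1 hu hadj fun h => hu' (h ▸ rfl)
        · simpa using hu)
    exact fun w hwu hwv => (htwins w hwv hwu).symm
  · refine twins_of_nested_of_iso (comp G A H) π hπ ?_
    have hcover : ∀ a, a ∈ A ∨ a ∈ B := fun a => by
      simpa using Set.ext_iff.mp hKS.2.2.1 a
    rintro (a | b) - - hadj
    · simp only [comp_adj_inr_inl, comp_adj_inl_inl] at hadj ⊢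
      by_contra ha
      exact hKS.2.1 ((hcover u).resolve_left hu) ((hcover a).resolve_left ha) hadj.ne hadj
    · exact absurd (by simpa using hadj) hu

end Tysh
end
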